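/- Fix an integer d ≥ 3 and reals ρ, λ > 0 with ρ·λ^d ≥ ∑_{n=1}^{∞} n^{−d/2}. Let (N_j) be a sequence of positive integers tending to infinity and set L_j = (N_j/ρ)^{1/d}. For n ≥ 1 let q_n^{(j)} = ∑_{z∈ℤ^d} exp(−π n λ² ‖z‖²/L_j²), and define Q^{(j)} : ℕ → ℝ by Q^{(j)}(0) = 1 and Q^{(j)}(N) = (1/N) ∑_{n=1}^{N} q_n^{(j)} Q^{(j)}(N−n). Then (1/L_j^d)·ln Q^{(j)}(N_j) converges as j → ∞ to (∑_{n=1}^{∞} n^{−(1+d/2)})/λ^d. -/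

import Mathlib

noncomputable def bgR (a : ℕ → ℝ) : ℕ → ℝ
  | 0 => 1
  | M + 1 => (1 / ((M : ℝ) + 1)) * ∑ i : Fin (M + 1), a (i + 1) * bgR a (M - i)
termination_by M => M
decreasing_by omega

theorem bgR_zero (a : ℕ → ℝ) : bgR a 0 = 1 := by rw [bgR]

theorem bgR_succ (a : ℕ → ℝ) (M : ℕ) : ((M : ℝ) + 1) * bgR a (M + 1) =
    ∑ i ∈ Finset.range (M + 1), a (i + 1) * bgR a (M - i) := by
  rw [bgR, Finset.sum_range]
  have : (M : ℝ) + 1 ≠ 0 := by positivity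
  field_simp

theorem bgR_nonneg (a : ℕ → ℝ) (ha : ∀ n, 0 ≤ a (n + 1)) (M : ℕ) : 0 ≤ bgR a M := by
  induction M using Nat.strong_induction_on with
  | _ M ih =>
    cases M with
    | zero => rw [bgR_zero]; norm_num
    | succ M =>
      have h := bgR_succ a M
      have h2 : 0 ≤ ((M : ℝ) + 1) * bgR a (M + 1) := by
        rw [h]
        exact Finset.sum_nonneg fun i _ => mul_nonneg (ha i) (ih _ (by omega))
      exact nonneg_of_mul_nonneg_right h2 (by positivity)

noncomputable def bgF (a : ℕ → ℝ) (K : ℕ) (x : ℝ) : ℝ :=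
  ∑ M ∈ Finset.range K, bgR a M * x ^ M

theorem bgF_succ (a : ℕ → ℝ) (K : ℕ) (x : ℝ) :
    bgF a (K + 1) x = bgF a K x + bgR a K * x ^ K := Finset.sum_range_succ _ _

theorem bgF_zero (a : ℕ → ℝ) (x : ℝ) : bgF a 0 x = 0 := by simp [bgF]

theorem bgF_mono (a : ℕ → ℝ) (ha : ∀ n, 0 ≤ a (n + 1)) {K K' : ℕ} (h : K ≤ K') {x : ℝ}
    (hx : 0 ≤ x) : bgF a K x ≤ bgF a K' x := by
  refine Finset.sum_le_sum_of_subset_of_nonneg (Finset.range_mono h) ?_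
  intro M _ _
  exact mul_nonneg (bgR_nonneg a ha M) (pow_nonneg hx M)

theorem bgF_nonneg (a : ℕ → ℝ) (ha : ∀ n, 0 ≤ a (n + 1)) (K : ℕ) {x : ℝ}
    (hx : 0 ≤ x) : 0 ≤ bgF a K x :=
  Finset.sum_nonneg fun M _ => mul_nonneg (bgR_nonneg a ha M) (pow_nonneg hx M)

theorem bgF_at_zero (a : ℕ → ℝ) (K : ℕ) : bgF a (K + 1) 0 = 1 := by
  unfold bgF
  rw [Finset.sum_range_succ']
  simp [bgR_zero]

/-- the moment identity -/
theorem bg_moment (a : ℕ → ℝ) (K : ℕ) (x : ℝ) :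
    ∑ M ∈ Finset.range (K + 1), (M : ℝ) * (bgR a M * x ^ M) =
      ∑ i ∈ Finset.range K, a (i + 1) * x ^ (i + 1) * bgF a (K - i) x := by
  induction K with
  | zero => simp
  | succ K ih =>
    rw [Finset.sum_range_succ, ih]
    have h1 : ((K + 1 : ℕ) : ℝ) * (bgR a (K + 1) * x ^ (K + 1)) =
        ∑ i ∈ Finset.range (K + 1), a (i + 1) * x ^ (i + 1) * (bgR a (K - i) * x ^ (K - i)) := by
      rw [← mul_assoc]
      push_cast
      rw [bgR_succ, Finset.sum_mul]
      refine Finset.sum_congr rfl fun i hi => ?_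
      have hi' : i ≤ K := by simpa [Nat.lt_succ_iff] using hi
      have : x ^ (K + 1) = x ^ (i + 1) * x ^ (K - i) := by
        rw [← pow_add]; congr 1; omega
      rw [this]; ring
    have h2 : ∑ i ∈ Finset.range (K + 1), a (i + 1) * x ^ (i + 1) * bgF a (K + 1 - i) x =
        ∑ i ∈ Finset.range (K + 1), (a (i + 1) * x ^ (i + 1) * bgF a (K - i) x +
          a (i + 1) * x ^ (i + 1) * (bgR a (K - i) * x ^ (K - i))) := by
      refine Finset.sum_congr rfl fun i hi => ?_
      have hi' : i ≤ K := by simpa [Nat.lt_succ_iff] using hi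
      rw [Nat.succ_sub hi', bgF_succ]; ring
    rw [h1, h2, Finset.sum_add_distrib]
    congr 1
    rw [Finset.sum_range_succ]
    simp [bgF_zero]

theorem bgF_hasDerivAt (a : ℕ → ℝ) (K : ℕ) (x : ℝ) :
    HasDerivAt (bgF a K) (∑ M ∈ Finset.range K, bgR a M * ((M : ℝ) * x ^ (M - 1))) x := by
  unfold bgF
  have := HasDerivAt.fun_sum (u := Finset.range K) (A := fun M x => bgR a M * x ^ M)
    (A' := fun M => bgR a M * ((M : ℝ) * x ^ (M - 1))) (x := x)
    (fun M _ => (hasDerivAt_pow M x).const_mul _)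
  exact this

theorem bgF_deriv_mul (a : ℕ → ℝ) (K : ℕ) (x : ℝ) :
    x * (∑ M ∈ Finset.range (K + 1), bgR a M * ((M : ℝ) * x ^ (M - 1))) =
      ∑ i ∈ Finset.range K, a (i + 1) * x ^ (i + 1) * bgF a (K - i) x := by
  rw [← bg_moment, Finset.mul_sum]
  refine Finset.sum_congr rfl fun M _ => ?_
  cases M with
  | zero => simp
  | succ M => simp only [Nat.add_sub_cancel]; ring

noncomputable def bgA (a : ℕ → ℝ) (K : ℕ) (x : ℝ) : ℝ :=
  ∑ i ∈ Finset.range K, a (i + 1) / ((i : ℝ) + 1) * x ^ (i + 1)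

theorem bgA_hasDerivAt (a : ℕ → ℝ) (K : ℕ) (x : ℝ) :
    HasDerivAt (bgA a K) (∑ i ∈ Finset.range K, a (i + 1) * x ^ i) x := by
  unfold bgA
  have := HasDerivAt.fun_sum (u := Finset.range K)
    (A := fun i x => a (i + 1) / ((i : ℝ) + 1) * x ^ (i + 1))
    (A' := fun i => a (i + 1) / ((i : ℝ) + 1) * (((i + 1 : ℕ) : ℝ) * x ^ (i + 1 - 1))) (x := x)
    (fun i _ => (hasDerivAt_pow (i + 1) x).const_mul _)
  refine this.congr_deriv ?_
  refine Finset.sum_congr rfl fun i _ => ?_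
  have : (i : ℝ) + 1 ≠ 0 := by positivity
  push_cast
  field_simp

theorem bgA_zero (a : ℕ → ℝ) (K : ℕ) : bgA a K 0 = 0 := by simp [bgA]

theorem bg_upper (a : ℕ → ℝ) (ha : ∀ n, 0 ≤ a (n + 1)) (K : ℕ) :
    bgF a (K + 1) 1 ≤ Real.exp (bgA a K 1) := by
  have hder : ∀ x, HasDerivAt (fun x => bgF a (K + 1) x * Real.exp (- bgA a K x))
      _ x := fun x => (bgF_hasDerivAt a (K + 1) x).mul ((bgA_hasDerivAt a K x).neg.exp)
  have hanti : AntitoneOn (fun x => bgF a (K + 1) x * Real.exp (- bgA a K x)) (Set.Icc 0 1) := by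
    refine antitoneOn_of_deriv_nonpos (convex_Icc _ _)
      (fun x _ => (hder x).continuousAt.continuousWithinAt)
      (fun x _ => (hder x).differentiableAt.differentiableWithinAt) ?_
    intro x hx
    rw [interior_Icc] at hx
    rw [(hder x).deriv]
    have h1 := bgF_deriv_mul a K x
    have h2 : ∑ i ∈ Finset.range K, a (i + 1) * x ^ (i + 1) * bgF a (K - i) x ≤
        x * (∑ i ∈ Finset.range K, a (i + 1) * x ^ i) * bgF a (K + 1) x := by
      rw [Finset.mul_sum, Finset.sum_mul]
      refine Finset.sum_le_sum fun i _ => ?_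
      have : bgF a (K - i) x ≤ bgF a (K + 1) x := bgF_mono a ha (by omega) hx.1.le
      have h3 : 0 ≤ a (i + 1) * x ^ (i + 1) := mul_nonneg (ha i) (pow_nonneg hx.1.le _)
      calc _ ≤ a (i + 1) * x ^ (i + 1) * bgF a (K + 1) x := mul_le_mul_of_nonneg_left this h3
        _ = _ := by ring
    rw [← h1] at h2
    rw [mul_assoc] at h2
    have h3 := le_of_mul_le_mul_left h2 hx.1
    have := mul_le_mul_of_nonneg_right h3 (Real.exp_nonneg (- bgA a K x))
    simp only [Pi.neg_apply] at *
    linarith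
  have := hanti (Set.left_mem_Icc.2 zero_le_one) (Set.right_mem_Icc.2 zero_le_one) zero_le_one
  simp only [bgF_at_zero, bgA_zero] at this
  rw [Real.exp_neg] at this
  have hp := Real.exp_pos (bgA a K 1)
  rw [← div_eq_mul_inv, div_le_iff₀ hp] at this
  simpa using this

theorem bg_markov (a : ℕ → ℝ) (ha : ∀ n, 0 ≤ a (n + 1)) (n₀ : ℕ) (hz : ∀ i, n₀ ≤ i → a (i + 1) = 0)
    (k K : ℕ) (x : ℝ) (hx : 0 ≤ x) :
    ((k : ℝ) + 1) * (bgF a (K + 1) x - bgF a (k + 1) x) ≤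
      (∑ i ∈ Finset.range n₀, a (i + 1) * x ^ (i + 1)) * bgF a (K + 1) x := by
  have hF := bgF_nonneg a ha (K + 1) hx
  have hm : 0 ≤ ∑ i ∈ Finset.range n₀, a (i + 1) * x ^ (i + 1) :=
    Finset.sum_nonneg fun i _ => mul_nonneg (ha i) (pow_nonneg hx _)
  rcases le_total K k with h | h
  · have := bgF_mono a ha (Nat.succ_le_succ h) hx
    have h1 : ((k : ℝ) + 1) * (bgF a (K + 1) x - bgF a (k + 1) x) ≤ 0 :=
      mul_nonpos_of_nonneg_of_nonpos (by positivity) (by simpa using this)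
    exact h1.trans (mul_nonneg hm hF)
  · have h1 : bgF a (K + 1) x - bgF a (k + 1) x =
        ∑ M ∈ Finset.Ico (k + 1) (K + 1), bgR a M * x ^ M := by
      unfold bgF
      rw [Finset.sum_Ico_eq_sub _ (by omega)]
    have h2 : ((k : ℝ) + 1) * (bgF a (K + 1) x - bgF a (k + 1) x) ≤
        ∑ M ∈ Finset.range (K + 1), (M : ℝ) * (bgR a M * x ^ M) := by
      rw [h1, Finset.mul_sum, Finset.range_eq_Ico]
      calc _ ≤ ∑ M ∈ Finset.Ico (k + 1) (K + 1), (M : ℝ) * (bgR a M * x ^ M) := by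
            refine Finset.sum_le_sum fun M hM => ?_
            refine mul_le_mul_of_nonneg_right ?_ (mul_nonneg (bgR_nonneg a ha M) (pow_nonneg hx M))
            exact_mod_cast (Finset.mem_Ico.1 hM).1
        _ ≤ _ := by
            refine Finset.sum_le_sum_of_subset_of_nonneg
              (Finset.Ico_subset_Ico (by omega) le_rfl) fun M _ _ => ?_
            exact mul_nonneg (Nat.cast_nonneg _)
              (mul_nonneg (bgR_nonneg a ha M) (pow_nonneg hx M))
    refine h2.trans ?_
    rw [bg_moment, Finset.sum_mul]
    calc _ ≤ ∑ i ∈ Finset.range K, a (i + 1) * x ^ (i + 1) * bgF a (K + 1) x := by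
          refine Finset.sum_le_sum fun i _ => ?_
          exact mul_le_mul_of_nonneg_left (bgF_mono a ha (by omega) hx)
            (mul_nonneg (ha i) (pow_nonneg hx _))
      _ ≤ ∑ i ∈ Finset.range (max K n₀), a (i + 1) * x ^ (i + 1) * bgF a (K + 1) x := by
          refine Finset.sum_le_sum_of_subset_of_nonneg
            (Finset.range_mono (le_max_left _ _)) fun i _ _ => ?_
          exact mul_nonneg (mul_nonneg (ha i) (pow_nonneg hx _)) hF
      _ = _ := by
          symm
          refine Finset.sum_subset (Finset.range_mono (le_max_right _ _)) fun i _ hi => ?_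
          rw [hz i (by simpa using hi)]; ring

theorem bg_lower1 (a : ℕ → ℝ) (ha : ∀ n, 0 ≤ a (n + 1)) (n₀ : ℕ)
    (hz : ∀ i, n₀ ≤ i → a (i + 1) = 0) (k : ℕ) :
    Real.exp (bgA a n₀ 1 - (∑ i ∈ Finset.range n₀, a (i + 1)) ^ 2 / ((k : ℝ) + 1))
      ≤ bgF a (k + n₀ + 1) 1 := by
  set c : ℝ := (∑ i ∈ Finset.range n₀, a (i + 1)) ^ 2 / ((k : ℝ) + 1) with hc
  have hk : (0 : ℝ) < (k : ℝ) + 1 := by positivity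
  have hder : ∀ x, HasDerivAt
      (fun x => bgF a (k + n₀ + 1) x * Real.exp (- (bgA a n₀ x - c * x)))
      _ x := fun x => (bgF_hasDerivAt a (k + n₀ + 1) x).mul
        (((bgA_hasDerivAt a n₀ x).sub ((hasDerivAt_id x).const_mul c)).neg.exp)
  have hmono : MonotoneOn (fun x => bgF a (k + n₀ + 1) x * Real.exp (- (bgA a n₀ x - c * x)))
      (Set.Icc 0 1) := by
    refine monotoneOn_of_deriv_nonneg (convex_Icc _ _)
      (fun x _ => (hder x).continuousAt.continuousWithinAt)
      (fun x _ => (hder x).differentiableAt.differentiableWithinAt) ?_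
    intro x hx
    rw [interior_Icc] at hx
    rw [(hder x).deriv]
    have h1 := bgF_deriv_mul a (k + n₀) x
    set D := ∑ M ∈ Finset.range (k + n₀ + 1), bgR a M * ((M : ℝ) * x ^ (M - 1))
    set m := ∑ i ∈ Finset.range n₀, a (i + 1) * x ^ i with hm
    set F := bgF a (k + n₀ + 1) x with hFdef
    have hF : 0 ≤ F := bgF_nonneg a ha _ hx.1.le
    have hxm : ∑ i ∈ Finset.range n₀, a (i + 1) * x ^ (i + 1) = x * m := by
      rw [hm, Finset.mul_sum]
      exact Finset.sum_congr rfl fun i _ => by ring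
    have hm0 : 0 ≤ m := Finset.sum_nonneg fun i _ => mul_nonneg (ha i) (pow_nonneg hx.1.le _)
    have hm1 : m ≤ ∑ i ∈ Finset.range n₀, a (i + 1) := by
      refine Finset.sum_le_sum fun i _ => ?_
      exact mul_le_of_le_one_right (ha i) (pow_le_one₀ hx.1.le hx.2.le)
    have h2 : x * m * bgF a (k + 1) x ≤ x * D := by
      rw [h1, ← hxm, Finset.sum_mul]
      calc _ ≤ ∑ i ∈ Finset.range n₀, a (i + 1) * x ^ (i + 1) * bgF a (k + n₀ - i) x := by
            refine Finset.sum_le_sum fun i hi => ?_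
            have := Finset.mem_range.1 hi
            exact mul_le_mul_of_nonneg_left (bgF_mono a ha (by omega) hx.1.le)
              (mul_nonneg (ha i) (pow_nonneg hx.1.le _))
        _ ≤ _ := by
            refine Finset.sum_le_sum_of_subset_of_nonneg
              (Finset.range_mono (by omega)) fun i _ _ => ?_
            exact mul_nonneg (mul_nonneg (ha i) (pow_nonneg hx.1.le _)) (bgF_nonneg a ha _ hx.1.le)
    have h3 : m * bgF a (k + 1) x ≤ D := by
      rw [mul_assoc] at h2
      exact le_of_mul_le_mul_left h2 hx.1
    have h4 := bg_markov a ha n₀ hz k (k + n₀) x hx.1.le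
    rw [hxm, ← hFdef] at h4
    have h5 : F - bgF a (k + 1) x ≤ x * m * F / ((k : ℝ) + 1) := by
      rw [le_div_iff₀ hk]; linarith
    have h6 : m * (x * m * F / ((k : ℝ) + 1)) ≤ c * F := by
      rw [hc]
      have : m * (x * m) ≤ (∑ i ∈ Finset.range n₀, a (i + 1)) ^ 2 := by
        have : m * (x * m) ≤ m * (1 * m) := by
          gcongr; exact hx.2.le
        nlinarith
      calc _ = m * (x * m) / ((k : ℝ) + 1) * F := by ring
        _ ≤ _ := by gcongr
    have h7 : (m - c) * F ≤ D := by
      have := mul_le_mul_of_nonneg_left h5 hm0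
      nlinarith
    have := mul_le_mul_of_nonneg_right h7 (Real.exp_nonneg (- (bgA a n₀ x - c * x)))
    simp only [Pi.neg_apply, Pi.sub_apply, id] at *
    linarith
  have := hmono (Set.left_mem_Icc.2 zero_le_one) (Set.right_mem_Icc.2 zero_le_one) zero_le_one
  simp only [bgF_at_zero, bgA_zero] at this
  rw [Real.exp_neg (bgA a n₀ 1 - c * 1)] at this
  have hp := Real.exp_pos (bgA a n₀ 1 - c * 1)
  rw [← div_eq_mul_inv, le_div_iff₀ hp] at this
  simpa using this

theorem bg_lower (a : ℕ → ℝ) (ha : ∀ n, 0 ≤ a (n + 1)) (n₀ : ℕ)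
    (hz : ∀ i, n₀ ≤ i → a (i + 1) = 0) (N : ℕ)
    (hm : ∑ i ∈ Finset.range n₀, a (i + 1) ≤ (N : ℝ) + 1) :
    ((N : ℝ) + 1 - ∑ i ∈ Finset.range n₀, a (i + 1)) * Real.exp (bgA a n₀ 1) ≤
      ((N : ℝ) + 1) * bgF a (N + 1) 1 := by
  set m := ∑ i ∈ Finset.range n₀, a (i + 1) with hmdef
  have h1 : ∀ k : ℕ, ((N : ℝ) + 1 - m) * Real.exp (bgA a n₀ 1 - m ^ 2 / ((k : ℝ) + 1)) ≤
      ((N : ℝ) + 1) * bgF a (N + 1) 1 := by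
    intro k
    have h2 := bg_lower1 a ha n₀ hz k
    have h3 := bg_markov a ha n₀ hz N (k + n₀) 1 zero_le_one
    simp only [one_pow, mul_one] at h3
    rw [← hmdef] at h2 h3
    have := mul_le_mul_of_nonneg_left h2 (sub_nonneg.2 hm)
    linarith
  have h2 : Filter.Tendsto (fun k : ℕ => ((N : ℝ) + 1 - m) *
      Real.exp (bgA a n₀ 1 - m ^ 2 / ((k : ℝ) + 1))) Filter.atTop
      (nhds (((N : ℝ) + 1 - m) * Real.exp (bgA a n₀ 1 - 0))) := by
    refine Filter.Tendsto.const_mul _ ((Real.continuous_exp.tendsto _).comp ?_)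
    refine tendsto_const_nhds.sub ?_
    have := (tendsto_one_div_add_atTop_nhds_zero_nat (𝕜 := ℝ)).const_mul (m ^ 2)
    simpa [div_eq_mul_inv] using this
  rw [sub_zero] at h2
  exact le_of_tendsto' h2 h1

/-- partial sums satisfy the recursion with shifted weights -/
theorem bg_shift (b : ℕ → ℝ) (M : ℕ) :
    ((M : ℝ) + 1) * bgF b (M + 2) 1 =
      ∑ i ∈ Finset.range (M + 1), (1 + b (i + 1)) * bgF b (M - i + 1) 1 := by
  have h1 := bg_moment b (M + 1) 1
  simp only [one_pow, mul_one] at h1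
  have h2 : ∀ i ∈ Finset.range (M + 1), (1 + b (i + 1)) * bgF b (M - i + 1) 1 =
      bgF b (M + 1 - i) 1 + b (i + 1) * bgF b (M + 1 - i) 1 := by
    intro i hi
    have hi' : i ≤ M := by simpa [Nat.lt_succ_iff] using hi
    rw [Nat.succ_sub hi']; ring
  rw [Finset.sum_congr rfl h2, Finset.sum_add_distrib, ← h1]
  have h3 : ∀ M : ℕ, ∑ i ∈ Finset.range (M + 1), bgF b (M + 1 - i) 1 =
      ∑ m ∈ Finset.range (M + 2), ((M : ℝ) + 1 - m) * bgR b m := by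
    intro M
    have := Finset.sum_range_reflect (fun i => bgF b (i + 1) 1) (M + 1)
    have e : ∑ i ∈ Finset.range (M + 1), bgF b (M + 1 - i) 1 =
        ∑ i ∈ Finset.range (M + 1), bgF b (i + 1) 1 := by
      rw [← this]
      refine Finset.sum_congr rfl fun i hi => ?_
      have hi' : i < M + 1 := by simpa using hi
      congr 1; omega
    rw [e]
    clear e this
    induction M with
    | zero => simp [bgF, Finset.sum_range_succ]
    | succ M ih =>
      rw [Finset.sum_range_succ, ih, Finset.sum_range_succ _ (M + 2)]
      unfold bgF
      push_cast
      simp only [one_pow, mul_one]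
      rw [show M + 1 + 1 = M + 2 from rfl, ← Finset.sum_add_distrib]
      have : ((M : ℝ) + 1 + 1 - (M + 2)) = 0 := by ring
      rw [this, zero_mul, add_zero]
      refine Finset.sum_congr rfl fun i _ => by ring
  rw [h3, ← Finset.sum_add_distrib]
  unfold bgF
  rw [Finset.mul_sum]
  refine Finset.sum_congr rfl fun i _ => by simp; ring

noncomputable def bgTheta (t : ℝ) : ℝ := ∑' k : ℤ, Real.exp (-Real.pi * t * (k : ℝ) ^ 2)

theorem bgTheta_summable {t : ℝ} (ht : 0 < t) :
    Summable fun k : ℤ => Real.exp (-Real.pi * t * (k : ℝ) ^ 2) := by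
  have := HurwitzKernelBounds.summable_f_int 0 0 ht
  refine this.congr fun k => ?_
  simp only [HurwitzKernelBounds.f_int, pow_zero, one_mul, add_zero]
  congr 1; ring

theorem bgTheta_func {t : ℝ} (ht : 0 < t) : bgTheta t = 1 / t ^ (1 / 2 : ℝ) * bgTheta (1 / t) := by
  unfold bgTheta
  rw [Real.tsum_exp_neg_mul_int_sq ht]
  congr 1
  refine tsum_congr fun k => ?_
  congr 1; ring

theorem bgTheta_one_le {t : ℝ} (ht : 0 < t) : 1 ≤ bgTheta t := by
  have := (bgTheta_summable ht).le_tsum 0 (fun _ _ => (Real.exp_pos _).le)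
  simpa [bgTheta] using this

theorem bgTheta_anti {s t : ℝ} (hs : 0 < s) (h : s ≤ t) : bgTheta t ≤ bgTheta s := by
  refine (bgTheta_summable (hs.trans_le h)).tsum_le_tsum (fun k => ?_) (bgTheta_summable hs)
  refine Real.exp_le_exp.2 ?_
  have : 0 ≤ Real.pi * (k : ℝ) ^ 2 := by positivity
  nlinarith

theorem bgTheta_tendsto : Filter.Tendsto bgTheta Filter.atTop (nhds 1) := by
  have h : Filter.Tendsto (fun t => ∑' k : ℤ, Real.exp (-Real.pi * t * (k : ℝ) ^ 2)) Filter.atTop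
      (nhds (∑' k : ℤ, if k = 0 then (1 : ℝ) else 0)) := by
    refine tendsto_tsum_of_dominated_convergence (bgTheta_summable one_pos) ?_ ?_
    · intro k
      by_cases hk : k = 0
      · simp [hk]
      · simp only [hk, if_false]
        refine Real.tendsto_exp_atBot.comp ?_
        have hk2 : (0 : ℝ) < Real.pi * (k : ℝ) ^ 2 := by
          have : (k : ℝ) ≠ 0 := by exact_mod_cast hk
          positivity
        have := Filter.tendsto_neg_atTop_atBot.comp
          (Filter.tendsto_id.const_mul_atTop hk2)
        refine this.congr fun t => ?_
        simp; ring
    · filter_upwards [Filter.eventually_ge_atTop (1 : ℝ)] with t ht k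
      rw [Real.norm_eq_abs, Real.abs_exp]
      refine Real.exp_le_exp.2 ?_
      have : 0 ≤ Real.pi * (k : ℝ) ^ 2 := by positivity
      nlinarith
  rw [tsum_ite_eq] at h
  exact h

theorem bg_pi_hasSum (f : ℤ → ℝ) (hf : Summable f) (h0 : ∀ k, 0 ≤ f k) (d : ℕ) :
    HasSum (fun z : Fin d → ℤ => ∏ i, f (z i)) ((∑' k, f k) ^ d) := by
  induction d with
  | zero => simp
  | succ d ih =>
    rw [← (Fin.consEquiv (fun _ : Fin (d + 1) => ℤ)).hasSum_iff]
    have hs := hf.mul_of_nonneg ih.summable h0 (fun z => Finset.prod_nonneg fun i _ => h0 _)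
    have := hf.hasSum.mul ih hs
    rw [pow_succ']
    have e : ((fun z : Fin (d + 1) → ℤ => ∏ i, f (z i)) ∘ Fin.consEquiv (fun _ => ℤ)) =
        fun x : ℤ × (Fin d → ℤ) => f x.1 * ∏ i, f (x.2 i) := by
      funext p
      simp [Fin.consEquiv, Fin.prod_univ_succ]
    rw [e]
    exact this

theorem bg_q (d : ℕ) (lam L : ℝ) (hlam : 0 < lam) (hL : 0 < L) (n : ℕ) (hn : 1 ≤ n) :
    ∑' z : Fin d → ℤ,
      Real.exp (-Real.pi * n * lam ^ 2 * (∑ i, ((z i : ℝ)) ^ 2) / L ^ 2) =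
    bgTheta (n * lam ^ 2 / L ^ 2) ^ d := by
  have hn' : (0 : ℝ) < n := by exact_mod_cast hn
  have ht : 0 < n * lam ^ 2 / L ^ 2 := by positivity
  have := bg_pi_hasSum _ (bgTheta_summable ht) (fun _ => (Real.exp_pos _).le) d
  unfold bgTheta
  rw [← this.tsum_eq]
  refine tsum_congr fun z => ?_
  rw [← Real.exp_sum, ← Finset.mul_sum]
  congr 1; ring

theorem bg_tpow (d : ℕ) (lam L x : ℝ) (hlam : 0 < lam) (hL : 0 < L) (hx : 0 < x) :
    (1 / (x * lam ^ 2 / L ^ 2) ^ (1 / 2 : ℝ)) ^ d = L ^ d * (1 / x ^ ((d : ℝ) / 2) / lam ^ d) := by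
  rw [← Real.sqrt_eq_rpow, Real.sqrt_div (by positivity), Real.sqrt_mul hx.le,
    Real.sqrt_sq hlam.le, Real.sqrt_sq hL.le]
  have : x ^ ((d : ℝ) / 2) = Real.sqrt x ^ d := by
    rw [Real.sqrt_eq_rpow, ← Real.rpow_natCast, ← Real.rpow_mul hx.le]
    congr 1; ring
  rw [this]
  have := Real.sqrt_pos.2 hx
  rw [one_div_div, div_pow, mul_pow]
  field_simp

theorem bg_q_bound (d : ℕ) (lam L x : ℝ) (hlam : 0 < lam) (hL : 0 < L) (hx : 0 < x) :
    bgTheta (x * lam ^ 2 / L ^ 2) ^ d ≤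
      bgTheta 1 ^ d * (1 + L ^ d * (1 / x ^ ((d : ℝ) / 2) / lam ^ d)) := by
  have ht : 0 < x * lam ^ 2 / L ^ 2 := by positivity
  rw [← bg_tpow d lam L x hlam hL hx]
  set t := x * lam ^ 2 / L ^ 2
  have h1 := bgTheta_one_le ht
  have h2 := bgTheta_one_le one_pos
  rcases le_total 1 t with h | h
  · have := bgTheta_anti one_pos h
    calc bgTheta t ^ d ≤ bgTheta 1 ^ d := by gcongr
      _ ≤ _ := le_mul_of_one_le_right (by positivity) (by
        have : 0 ≤ (1 / t ^ (1 / 2 : ℝ)) ^ d := by positivity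
        linarith)
  · have h3 : bgTheta (1 / t) ≤ bgTheta 1 := bgTheta_anti one_pos (by
      rw [le_div_iff₀ ht]; linarith)
    have h4 := bgTheta_one_le (one_div_pos.2 ht)
    rw [bgTheta_func ht, mul_pow, mul_comm]
    have : 0 ≤ (1 / t ^ (1 / 2 : ℝ)) ^ d := by positivity
    calc _ ≤ bgTheta 1 ^ d * (1 / t ^ (1 / 2 : ℝ)) ^ d := by gcongr
      _ ≤ _ := by gcongr; linarith

theorem bg_q_eq (d : ℕ) (lam L x : ℝ) (hlam : 0 < lam) (hL : 0 < L) (hx : 0 < x) :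
    bgTheta (x * lam ^ 2 / L ^ 2) ^ d / L ^ d =
      (1 / x ^ ((d : ℝ) / 2) / lam ^ d) * bgTheta (L ^ 2 / (x * lam ^ 2)) ^ d := by
  have ht : 0 < x * lam ^ 2 / L ^ 2 := by positivity
  rw [bgTheta_func ht, mul_pow, bg_tpow d lam L x hlam hL hx, one_div_div]
  field_simp

/-- comparison of two recursions -/
theorem bg_compare (a Q : ℕ → ℝ) (b : ℕ → ℝ) (hb : ∀ n, 0 ≤ b (n + 1))
    (hab : ∀ n, 1 + b (n + 1) ≤ a (n + 1))
    (hQ0 : Q 0 = 1) (hQ : ∀ M : ℕ, ((M : ℝ) + 1) * Q (M + 1) =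
      ∑ i ∈ Finset.range (M + 1), a (i + 1) * Q (M - i)) (M : ℕ) :
    bgF b (M + 1) 1 ≤ Q M := by
  induction M using Nat.strong_induction_on with
  | _ M ih =>
    cases M with
    | zero => simp [bgF, bgR_zero, hQ0]
    | succ M =>
      have h1 := bg_shift b M
      have h2 := hQ M
      have h3 : ((M : ℝ) + 1) * bgF b (M + 2) 1 ≤ ((M : ℝ) + 1) * Q (M + 1) := by
        rw [h1, h2]
        refine Finset.sum_le_sum fun i _ => ?_
        have := bgF_nonneg b hb (M - i + 1) zero_le_one
        exact mul_le_mul (hab i) (ih _ (by omega)) this (by linarith [hab i, hb i])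
      exact le_of_mul_le_mul_left h3 (by positivity)

theorem bg_eq (a Q : ℕ → ℝ)
    (hQ0 : Q 0 = 1) (hQ : ∀ M : ℕ, ((M : ℝ) + 1) * Q (M + 1) =
      ∑ i ∈ Finset.range (M + 1), a (i + 1) * Q (M - i)) (M : ℕ) :
    Q M = bgR a M := by
  induction M using Nat.strong_induction_on with
  | _ M ih =>
    cases M with
    | zero => rw [hQ0, bgR_zero]
    | succ M =>
      have h1 := bgR_succ a M
      have h2 := hQ M
      have h3 : ((M : ℝ) + 1) * Q (M + 1) = ((M : ℝ) + 1) * bgR a (M + 1) := by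
        rw [h1, h2]
        exact Finset.sum_congr rfl fun i _ => by rw [ih _ (by omega)]
      exact mul_left_cancel₀ (by positivity) h3

theorem ideal_gas_condensed_free_energy (d : ℕ) (hd : 3 ≤ d)
    (ρ lam : ℝ) (hρ : 0 < ρ) (hlam : 0 < lam)
    (hcrit : ∑' n : ℕ, 1 / ((n : ℝ) + 1) ^ ((d : ℝ) / 2) ≤ ρ * lam ^ d)
    (N : ℕ → ℕ) (hN1 : ∀ j, 1 ≤ N j)
    (hNtop : Filter.Tendsto N Filter.atTop Filter.atTop)
    (L : ℕ → ℝ) (hL : ∀ j, L j = ((N j : ℝ) / ρ) ^ ((1 : ℝ) / d))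
    (q : ℕ → ℕ → ℝ)
    (hq : ∀ j n, q j n = ∑' z : Fin d → ℤ,
      Real.exp (-Real.pi * n * lam ^ 2 * (∑ i, ((z i : ℝ)) ^ 2) / (L j) ^ 2))
    (Q : ℕ → ℕ → ℝ) (hQ0 : ∀ j, Q j 0 = 1)
    (hQ : ∀ j M, 1 ≤ M →
      Q j M = (1 / (M : ℝ)) * ∑ n ∈ Finset.Icc 1 M, q j n * Q j (M - n)) :
    Filter.Tendsto (fun j => (1 / (L j) ^ d) * Real.log (Q j (N j))) Filter.atTop
      (nhds ((∑' n : ℕ, 1 / ((n : ℝ) + 1) ^ (1 + (d : ℝ) / 2)) / lam ^ d)) := by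
  have hd0 : d ≠ 0 := by omega
  have hdr : (3 : ℝ) ≤ d := by exact_mod_cast hd
  have hNpos : ∀ j, (0 : ℝ) < N j := fun j => by exact_mod_cast hN1 j
  have hLpos : ∀ j, 0 < L j := fun j => by
    rw [hL]; exact Real.rpow_pos_of_pos (div_pos (hNpos j) hρ) _
  have hLd : ∀ j, L j ^ d = N j / ρ := fun j => by
    rw [hL, one_div, Real.rpow_inv_natCast_pow (div_pos (hNpos j) hρ).le hd0]
  have hLdpos : ∀ j, 0 < L j ^ d := fun j => pow_pos (hLpos j) d
  have hNr : Filter.Tendsto (fun j => (N j : ℝ) / ρ) Filter.atTop Filter.atTop :=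
    (tendsto_natCast_atTop_atTop.comp hNtop).atTop_div_const hρ
  have hLtop : Filter.Tendsto L Filter.atTop Filter.atTop := by
    have := (tendsto_rpow_atTop (y := (1 : ℝ) / d) (by positivity)).comp hNr
    exact this.congr fun j => (hL j).symm
  have hVinv : Filter.Tendsto (fun j => 1 / L j ^ d) Filter.atTop (nhds 0) := by
    have := hNr.inv_tendsto_atTop
    refine this.congr fun j => ?_
    simp [hLd]
  have hqθ : ∀ j n, q j (n + 1) = bgTheta (((n : ℝ) + 1) * lam ^ 2 / L j ^ 2) ^ d := by
    intro j n
    rw [hq, bg_q d lam (L j) hlam (hLpos j) (n + 1) (by omega)]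
    push_cast; rfl
  have hn1 : ∀ n : ℕ, (0 : ℝ) < (n : ℝ) + 1 := fun n => by positivity
  have hq1 : ∀ j n, 1 ≤ q j (n + 1) := by
    intro j n
    rw [hqθ]
    have := hLpos j
    have := hn1 n
    exact one_le_pow₀ (bgTheta_one_le (by positivity))
  set g : ℕ → ℝ := fun n => 1 / ((n : ℝ) + 1) ^ ((d : ℝ) / 2) with hg
  have hgpos : ∀ n, 0 < g n := fun n => one_div_pos.2 (Real.rpow_pos_of_pos (hn1 n) _)
  have hgs : Summable g := by
    have := (summable_nat_add_iff 1).2 (Real.summable_one_div_nat_rpow.2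
      (show (1 : ℝ) < (d : ℝ) / 2 by linarith))
    simpa [hg] using this
  have hg1 : ∀ n : ℕ, 1 / ((n : ℝ) + 1) ^ (1 + (d : ℝ) / 2) = g n / ((n : ℝ) + 1) := by
    intro n
    rw [Real.rpow_add (hn1 n), Real.rpow_one, hg]
    have := (Real.rpow_pos_of_pos (hn1 n) ((d : ℝ) / 2)).ne'
    have := (hn1 n).ne'
    field_simp
  simp_rw [hg1]
  have hg1s : Summable fun n : ℕ => g n / ((n : ℝ) + 1) := by
    refine hgs.of_nonneg_of_le (fun n => (div_pos (hgpos n) (hn1 n)).le) fun n => ?_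
    refine div_le_self (hgpos n).le ?_
    have : (0 : ℝ) ≤ n := Nat.cast_nonneg n
    linarith
  -- pointwise limit
  have hlim : ∀ n, Filter.Tendsto (fun j => q j (n + 1) / L j ^ d) Filter.atTop
      (nhds (g n / lam ^ d)) := by
    intro n
    have h1 : Filter.Tendsto (fun j => L j ^ 2 / (((n : ℝ) + 1) * lam ^ 2)) Filter.atTop
        Filter.atTop := by
      have := hn1 n
      exact ((Filter.tendsto_pow_atTop two_ne_zero).comp hLtop).atTop_div_const (by positivity)
    have h2 := ((bgTheta_tendsto.comp h1).pow d).const_mul (g n / lam ^ d)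
    simp only [one_pow, mul_one] at h2
    refine h2.congr fun j => ?_
    rw [hqθ, bg_q_eq d lam (L j) _ hlam (hLpos j) (hn1 n)]
    rfl
  -- recursion in convenient form
  have hrec : ∀ j, ∀ M : ℕ, ((M : ℝ) + 1) * Q j (M + 1) =
      ∑ i ∈ Finset.range (M + 1), q j (i + 1) * Q j (M - i) := by
    intro j M
    rw [hQ j (M + 1) (by omega)]
    have : (M : ℝ) + 1 ≠ 0 := (hn1 M).ne'
    push_cast
    rw [← mul_assoc, mul_one_div_cancel this, one_mul]
    rw [← Finset.Ico_add_one_right_eq_Icc, Finset.sum_Ico_eq_sum_range]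
    refine Finset.sum_congr (by simp) fun i _ => ?_
    rw [add_comm 1 i, Nat.add_sub_add_right]
  -- upper bound
  have hQpos : ∀ j, 0 < Q j (N j) := by
    intro j
    have h := bg_compare (q j) (Q j) (fun _ => 0) (fun _ => le_rfl)
      (fun n => by simpa using hq1 j n) (hQ0 j) (hrec j) (N j)
    have h2 := bgF_mono (fun _ => 0) (fun _ => le_rfl) (show 1 ≤ N j + 1 by omega)
      (zero_le_one (α := ℝ))
    have h3 : bgF (fun _ => 0) 1 1 = 1 := by simp [bgF, bgR_zero]
    linarith
  have hup : ∀ j, Real.log (Q j (N j)) ≤ ∑ i ∈ Finset.range (N j), q j (i + 1) / ((i : ℝ) + 1) := by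
    intro j
    have ha : ∀ n, 0 ≤ q j (n + 1) := fun n => zero_le_one.trans (hq1 j n)
    have h1 := bg_upper (q j) ha (N j)
    rw [bgF_succ, one_pow, mul_one, ← bg_eq (q j) (Q j) (hQ0 j) (hrec j)] at h1
    have h2 := bgF_nonneg (q j) ha (N j) (zero_le_one (α := ℝ))
    rw [Real.log_le_iff_le_exp (hQpos j)]
    have h3 : bgA (q j) (N j) 1 = ∑ i ∈ Finset.range (N j), q j (i + 1) / ((i : ℝ) + 1) := by
      simp [bgA]
    rw [← h3]; linarith
  have hU : Filter.Tendsto (fun j => ∑' i : ℕ, if i < N j then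
      (q j (i + 1) / L j ^ d) / ((i : ℝ) + 1) else 0) Filter.atTop
      (nhds (∑' i : ℕ, (g i / lam ^ d) / ((i : ℝ) + 1))) := by
    refine tendsto_tsum_of_dominated_convergence (bound := fun i : ℕ =>
      bgTheta 1 ^ d * (ρ * (1 / ((i : ℝ) + 1) ^ 2) + (g i / ((i : ℝ) + 1)) / lam ^ d)) ?_ ?_ ?_
    · refine Summable.mul_left _ (Summable.add (Summable.mul_left _ ?_) (hg1s.div_const _))
      have := (summable_nat_add_iff 1).2 (Real.summable_one_div_nat_pow.2 (show 1 < 2 by norm_num))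
      simpa using this
    · intro i
      refine ((hlim i).div_const _).congr' ?_
      filter_upwards [hNtop.eventually_gt_atTop i] with j hj
      rw [if_pos hj]
    · refine Filter.Eventually.of_forall fun j i => ?_
      have hi := hn1 i
      have hθ := bgTheta_one_le one_pos
      have hgi := hgpos i
      split_ifs with h
      · have h0 : 0 ≤ q j (i + 1) := zero_le_one.trans (hq1 j i)
        have hV := hLdpos j
        rw [Real.norm_of_nonneg (by positivity)]
        have hb := bg_q_bound d lam (L j) _ hlam (hLpos j) hi
        rw [← hqθ] at hb
        have h1 : 1 / L j ^ d ≤ ρ * (1 / ((i : ℝ) + 1)) := by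
          rw [hLd, one_div_div, div_eq_mul_one_div]
          have : (i : ℝ) + 1 ≤ N j := by exact_mod_cast h
          gcongr
        calc q j (i + 1) / L j ^ d / ((i : ℝ) + 1)
            ≤ bgTheta 1 ^ d * (1 + L j ^ d * (g i / lam ^ d)) / L j ^ d / ((i : ℝ) + 1) := by
              gcongr
          _ = bgTheta 1 ^ d * ((1 / L j ^ d) * (1 / ((i : ℝ) + 1)) +
                (g i / ((i : ℝ) + 1)) / lam ^ d) := by
              field_simp
          _ ≤ bgTheta 1 ^ d * ((ρ * (1 / ((i : ℝ) + 1))) * (1 / ((i : ℝ) + 1)) +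
                (g i / ((i : ℝ) + 1)) / lam ^ d) := by
              gcongr
          _ = _ := by rw [mul_assoc ρ, one_div_mul_one_div, ← sq]
      · rw [norm_zero]; positivity
  have hT : ∑' i : ℕ, (g i / lam ^ d) / ((i : ℝ) + 1) =
      (∑' n : ℕ, g n / ((n : ℝ) + 1)) / lam ^ d := by
    rw [← tsum_div_const]
    exact tsum_congr fun i => by ring
  rw [hT] at hU
  have hupper : ∀ j, (1 / L j ^ d) * Real.log (Q j (N j)) ≤ ∑' i : ℕ, if i < N j then
      (q j (i + 1) / L j ^ d) / ((i : ℝ) + 1) else 0 := by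
    intro j
    rw [tsum_eq_sum (s := Finset.range (N j)) (fun i hi => by
      rw [if_neg (by simpa using hi)])]
    have hV := hLdpos j
    calc _ ≤ (1 / L j ^ d) * ∑ i ∈ Finset.range (N j), q j (i + 1) / ((i : ℝ) + 1) := by
          gcongr; exact hup j
      _ = _ := by
          rw [Finset.mul_sum]
          refine Finset.sum_congr rfl fun i hi => ?_
          rw [if_pos (by simpa using hi)]; ring
  -- lower bound
  have hlower : ∀ n₀ : ℕ, ∀ a : ℝ, a < (∑ i ∈ Finset.range n₀, g i / ((i : ℝ) + 1)) / lam ^ d →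
      ∀ᶠ j in Filter.atTop, a < (1 / L j ^ d) * Real.log (Q j (N j)) := by
    intro n₀ a ha
    have hlim' : ∀ n, Filter.Tendsto (fun j => (q j (n + 1) - 1) / L j ^ d) Filter.atTop
        (nhds (g n / lam ^ d)) := by
      intro n
      have := (hlim n).sub hVinv
      rw [sub_zero] at this
      exact this.congr fun j => by ring
    set m : ℕ → ℝ := fun j => ∑ i ∈ Finset.range n₀, (q j (i + 1) - 1) with hm
    set A : ℕ → ℝ := fun j => ∑ i ∈ Finset.range n₀, (q j (i + 1) - 1) / ((i : ℝ) + 1) with hA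
    have hmlim : Filter.Tendsto (fun j => m j / N j) Filter.atTop
        (nhds ((∑ i ∈ Finset.range n₀, g i / lam ^ d) / ρ)) := by
      have := (tendsto_finsetSum (Finset.range n₀) (fun i _ => hlim' i)).div_const ρ
      refine this.congr fun j => ?_
      rw [← Finset.sum_div, hLd]
      have := (hNpos j).ne'
      field_simp
      rfl
    have hAlim : Filter.Tendsto (fun j => A j / L j ^ d) Filter.atTop
        (nhds ((∑ i ∈ Finset.range n₀, g i / ((i : ℝ) + 1)) / lam ^ d)) := by
      have := tendsto_finsetSum (Finset.range n₀) (fun i _ => (hlim' i).div_const ((i : ℝ) + 1))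
      rw [Finset.sum_div]
      have e : ∑ i ∈ Finset.range n₀, g i / lam ^ d / ((i : ℝ) + 1) =
          ∑ i ∈ Finset.range n₀, g i / ((i : ℝ) + 1) / lam ^ d :=
        Finset.sum_congr rfl fun i _ => by ring
      rw [← e]
      refine this.congr fun j => ?_
      rw [hA, Finset.sum_div]
      exact Finset.sum_congr rfl fun i _ => by ring
    have hs1 : (∑ i ∈ Finset.range n₀, g i / lam ^ d) / ρ < 1 := by
      have h1 : ∑ i ∈ Finset.range n₀, g i < ρ * lam ^ d := by
        have h2 := hgs.sum_le_tsum (Finset.range (n₀ + 1)) (fun i _ => (hgpos i).le)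
        rw [Finset.sum_range_succ] at h2
        have := hgpos n₀
        linarith
      rw [← Finset.sum_div, div_div, div_lt_one (by positivity), mul_comm]
      exact h1
    have hloglim : Filter.Tendsto (fun j => (1 / L j ^ d) * Real.log (1 - m j / N j) + A j / L j ^ d)
        Filter.atTop (nhds (0 * Real.log (1 - (∑ i ∈ Finset.range n₀, g i / lam ^ d) / ρ) +
          (∑ i ∈ Finset.range n₀, g i / ((i : ℝ) + 1)) / lam ^ d)) := by
      refine Filter.Tendsto.add (hVinv.mul ?_) hAlim
      exact (tendsto_const_nhds.sub hmlim).log (by linarith)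
    rw [zero_mul, zero_add] at hloglim
    filter_upwards [hloglim.eventually_const_lt ha, hmlim.eventually_lt_const hs1] with j h1 h2
    refine h1.trans_le ?_
    have hV := hLdpos j
    have hNj := hNpos j
    set b : ℕ → ℝ := fun n => if n ≤ n₀ then q j n - 1 else 0 with hbdef
    have hb0 : ∀ n, 0 ≤ b (n + 1) := by
      intro n
      simp only [hbdef]
      split_ifs
      · linarith [hq1 j n]
      · exact le_rfl
    have hab : ∀ n, 1 + b (n + 1) ≤ q j (n + 1) := by
      intro n
      simp only [hbdef]
      split_ifs
      · linarith
      · linarith [hq1 j n]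
    have hbz : ∀ i, n₀ ≤ i → b (i + 1) = 0 := by
      intro i hi
      simp only [hbdef]
      rw [if_neg (by omega)]
    have hbi : ∀ i ∈ Finset.range n₀, b (i + 1) = q j (i + 1) - 1 := by
      intro i hi
      have := Finset.mem_range.1 hi
      simp only [hbdef]
      rw [if_pos (by omega)]
    have hbm : ∑ i ∈ Finset.range n₀, b (i + 1) = m j := Finset.sum_congr rfl hbi
    have hbA : bgA b n₀ 1 = A j := by
      simp only [bgA, one_pow, mul_one, hA]
      exact Finset.sum_congr rfl fun i hi => by rw [hbi i hi]
    have hmlt : m j < N j := by rwa [div_lt_one hNj] at h2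
    have hm0 : 0 ≤ m j := Finset.sum_nonneg fun i _ => by linarith [hq1 j i]
    have hlow := bg_lower b hb0 n₀ hbz (N j) (by rw [hbm]; linarith)
    rw [hbm, hbA] at hlow
    have hcmp := bg_compare (q j) (Q j) b hb0 hab (hQ0 j) (hrec j) (N j)
    have h3 : (1 - m j / N j) * Real.exp (A j) ≤ Q j (N j) := by
      refine le_trans ?_ hcmp
      have h4 : 1 - m j / N j ≤ ((N j : ℝ) + 1 - m j) / ((N j : ℝ) + 1) := by
        rw [sub_div, div_self (by positivity)]
        have : m j / ((N j : ℝ) + 1) ≤ m j / N j := by gcongr; linarith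
        linarith
      calc _ ≤ ((N j : ℝ) + 1 - m j) / ((N j : ℝ) + 1) * Real.exp (A j) := by gcongr
        _ ≤ _ := by
          rw [div_mul_eq_mul_div, div_le_iff₀ (by positivity)]
          linarith
    have hpos : 0 < 1 - m j / N j := by linarith
    have h5 := Real.log_le_log (mul_pos hpos (Real.exp_pos _)) h3
    rw [Real.log_mul hpos.ne' (Real.exp_pos _).ne', Real.log_exp] at h5
    calc _ = (1 / L j ^ d) * (Real.log (1 - m j / N j) + A j) := by ring
      _ ≤ _ := by gcongr
  refine tendsto_order.2 ⟨fun a ha => ?_, fun a ha => ?_⟩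
  · have := (hg1s.hasSum.tendsto_sum_nat.div_const (lam ^ d)).eventually_const_lt ha
    obtain ⟨n₀, hn₀⟩ := this.exists
    exact hlower n₀ a hn₀
  · filter_upwards [hU.eventually_lt_const ha] with j hj
    exact (hupper j).trans_lt hj
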